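/- (Theorem 1, addition attack.) Fix T ∈ ℕ. For i = 1,…,T, let m_i be a finite set with n_i = |m_i|, let r_i ∈ ℕ, and let k_i be a sub-sampling size with k_i ≤ n_i. Let Ω_X be the set of tuples (z_1,…,z_T) where each z_i is a k_i-element subset of m_i, and let X be uniformly distributed on Ω_X. Let g be an arbitrary function from tuples to a label type, A a label, and p_A, p_B ∈ [0,1] reals with Pr(g(X) = A) ≥ p_A and Pr(g(X) = l) ≤ p_B for every label l ≠ A. Define δ_l = p_A − ⌊p_A·∏_{i=1}^T C(n_i,k_i)⌋/∏_{i=1}^T C(n_i,k_i) and δ_u = ⌈p_B·∏_{i=1}^T C(n_i,k_i)⌉/∏_{i=1}^T C(n_i,k_i) − p_B, and set e_i = n_i and n'_i = n_i + r_i. Suppose (∏_{i=1}^T C(n_i,k_i)/∏_{i=1}^T C(n'_i,k_i))·(p_A − δ_l − 1 + ∏_{i=1}^T C(e_i,k_i)/∏_{i=1}^T C(n_i,k_i)) ≥ (∏_{i=1}^T C(n_i,k_i)/∏_{i=1}^T C(n'_i,k_i))·(p_B + δ_u) + 1 − ∏_{i=1}^T C(e_i,k_i)/∏_{i=1}^T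 C(n'_i,k_i). Then for every choice of finite sets m'_1,…,m'_T with m_i ⊆ m'_i and |m'_i| ≤ n_i + r_i for all i, letting Y be uniformly distributed on the set Ω_Y of tuples (z_1,…,z_T) with each z_i a k_i-element subset of m'_i, we have Pr(g(Y) = A) ≥ Pr(g(Y) = l) for every label l ≠ A. -/

import Mathlib

/-- The probability of an event `P` under the uniform distribution on a finite set `Ω`:
`Pr(P) = |{x ∈ Ω : P x}| / |Ω|`. -/
noncomputable def uniformProb {β : Type*} (Ω : Finset β) (P : β → Prop) [DecidablePred P] : ℝ :=
  ((Ω.filter P).card : ℝ) / (Ω.card : ℝ)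

theorem card_filter_add_card_le_of_subset {β : Type*} [DecidableEq β] {s t : Finset β}
    (h : s ⊆ t) (P : β → Prop) [DecidablePred P] :
    (t.filter P).card + s.card ≤ (s.filter P).card + t.card := by
  have hsub : t.filter P ⊆ s.filter P ∪ (t \ s) := by
    intro x hx
    simp only [Finset.mem_filter, Finset.mem_union, Finset.mem_sdiff] at hx ⊢
    tauto
  have hle := (Finset.card_le_card hsub).trans (Finset.card_union_le _ _)
  have hcard := Finset.card_sdiff_add_card_eq_card h
  omega

theorem uniformProb_le_uniformProb_of_subset {β : Type*} {s t : Finset β} (h : s ⊆ t)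
    (P Q : β → Prop) [DecidablePred P] [DecidablePred Q]
    (hPQ : (s.filter Q).card + t.card ≤ (s.filter P).card + s.card) :
    uniformProb t Q ≤ uniformProb t P := by
  classical
  have hQ := card_filter_add_card_le_of_subset h Q
  have hP := Finset.card_le_card (Finset.filter_subset_filter P h)
  unfold uniformProb
  exact div_le_div_of_nonneg_right (Nat.cast_le.2 (by omega)) (Nat.cast_nonneg _)

theorem card_piFinset_powersetCard {ι : Type*} [Fintype ι] [DecidableEq ι] {α : ι → Type*}
    (m : ∀ i, Finset (α i)) (k : ι → ℕ) :
    (Fintype.piFinset fun i => (m i).powersetCard (k i)).card =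
      ∏ i, (m i).card.choose (k i) := by
  simp [Fintype.card_piFinset]

/-- The paper's Theorem 1 for addition attacks: an addition attack of size `(r 1, …, r T)`
adds at most `r i` new basic elements to modality `m i`, so the perturbed modality `m' i`
satisfies `m i ⊆ m' i` and `|m' i| ≤ n i + r i`.  With `e i = n i` and `n' i = n i + r i`,
if `Pr(g(X) = A) ≥ p_A`, `Pr(g(X) = l) ≤ p_B` for all `l ≠ A`, and the certification condition
holds, then for every such perturbation, `Pr(g(Y) = A) ≥ Pr(g(Y) = l)` for every `l ≠ A`. -/
theorem multimodal_certification_addition {T : ℕ} {α : Fin T → Type*}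
    [∀ i, DecidableEq (α i)] {L : Type*} [DecidableEq L]
    (m : ∀ i, Finset (α i)) (n r e n' k : Fin T → ℕ)
    (hn : ∀ i, (m i).card = n i) (hk : ∀ i, k i ≤ n i)
    (he : ∀ i, e i = n i) (hn' : ∀ i, n' i = n i + r i)
    (g : (∀ i, Finset (α i)) → L) (A : L) (pA pB : ℝ)
    (hpA0 : 0 ≤ pA) (hpA1 : pA ≤ 1) (hpB0 : 0 ≤ pB) (hpB1 : pB ≤ 1)
    (hA : uniformProb (Fintype.piFinset fun i => (m i).powersetCard (k i))
        (fun z => g z = A) ≥ pA)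
    (hB : ∀ l : L, l ≠ A →
      uniformProb (Fintype.piFinset fun i => (m i).powersetCard (k i))
        (fun z => g z = l) ≤ pB)
    (δl δu : ℝ)
    (hδl : δl = pA - (⌊pA * ∏ i, ((n i).choose (k i) : ℝ)⌋ : ℝ) / ∏ i, ((n i).choose (k i) : ℝ))
    (hδu : δu = (⌈pB * ∏ i, ((n i).choose (k i) : ℝ)⌉ : ℝ) / (∏ i, ((n i).choose (k i) : ℝ)) - pB)
    (hcond : ((∏ i, ((n i).choose (k i) : ℝ)) / (∏ i, ((n' i).choose (k i) : ℝ)))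
          * (pA - δl - 1 + (∏ i, ((e i).choose (k i) : ℝ)) / (∏ i, ((n i).choose (k i) : ℝ)))
      ≥ ((∏ i, ((n i).choose (k i) : ℝ)) / (∏ i, ((n' i).choose (k i) : ℝ))) * (pB + δu)
          + 1 - (∏ i, ((e i).choose (k i) : ℝ)) / (∏ i, ((n' i).choose (k i) : ℝ))) :
    ∀ m' : ∀ i, Finset (α i),
      (∀ i, m i ⊆ m' i) → (∀ i, (m' i).card ≤ n i + r i) →
      ∀ l : L, l ≠ A →
        uniformProb (Fintype.piFinset fun i => (m' i).powersetCard (k i)) (fun z => g z = A)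
          ≥ uniformProb (Fintype.piFinset fun i => (m' i).powersetCard (k i)) (fun z => g z = l) := by
  intro m' hsub hcard l hl
  have hXY : (Fintype.piFinset fun i => (m i).powersetCard (k i)) ⊆
      Fintype.piFinset fun i => (m' i).powersetCard (k i) :=
    Fintype.piFinset_subset _ _ fun i => Finset.powersetCard_mono (hsub i)
  have hX := card_piFinset_powersetCard m k
  have hY : (Fintype.piFinset fun i => (m' i).powersetCard (k i)).card ≤
      ∏ i, (n' i).choose (k i) := by
    rw [card_piFinset_powersetCard m' k]
    exact Finset.prod_le_prod' fun i _ => Nat.choose_le_choose _ (hn' i ▸ hcard i)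
  simp only [hn] at hX
  obtain rfl : e = n := funext he
  have hN : 0 < ∏ i, (e i).choose (k i) := Finset.prod_pos fun i _ => Nat.choose_pos (hk i)
  have hN' : 0 < ∏ i, (n' i).choose (k i) :=
    Finset.prod_pos fun i _ => Nat.choose_pos ((hk i).trans (by simp [hn' i]))
  have hBl := hB l hl
  unfold uniformProb at hA hBl
  simp only [← Nat.cast_prod] at hδl hδu hcond
  rw [hX] at hA hBl
  apply uniformProb_le_uniformProb_of_subset hXY
  rw [hX]
  generalize ∏ i, (e i).choose (k i) = N at *
  generalize ∏ i, (n' i).choose (k i) = N' at *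
  have hNR : (0 : ℝ) < N := by exact_mod_cast hN
  have hNR' : (0 : ℝ) < N' := by exact_mod_cast hN'
  rw [ge_iff_le, le_div_iff₀ hNR] at hA
  rw [div_le_iff₀ hNR] at hBl
  have hfloor := Int.floor_le (pA * N)
  have hceil := Int.le_ceil (pB * N)
  have hbound : (⌈pB * N⌉ : ℝ) + N' ≤ ⌊pA * N⌋ + N := by
    subst hδl hδu
    field_simp at hcond
    rw [mul_comm (N : ℝ) pA, mul_comm (N : ℝ) pB] at hcond
    linarith
  rw [← Nat.cast_le (α := ℝ)]
  push_cast
  have hYR := (Nat.cast_le (α := ℝ)).2 hY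
  linarith
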